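/- (Anisotropic product law with high vertical regularity on one factor) Let σ, σ' < 1 with σ + σ' > 0, and let s₀ > 1/2 and s₁ ≤ s₀ with s₀ + s₁ > 0. Then there exists a constant C > 0 such that for all Schwartz functions u and v on ℝ³, ‖uv‖_{H^{σ+σ'−1, s₁}} ≤ C ‖u‖_{H^{σ, s₀}} ‖v‖_{H^{σ', s₁}}. -/

import Mathlib

/- Anisotropic product law with high vertical regularity on one factor (Theorem "th:LoiUni"):
for σ, σ' < 1 with σ + σ' > 0, s₀ > 1/2 and s₁ ≤ s₀ with s₀ + s₁ > 0,
`‖uv‖_{H^{σ+σ'-1, s₁}} ≤ C ‖u‖_{H^{σ, s₀}} ‖v‖_{H^{σ', s₁}}`. -/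

open MeasureTheory Real
open scoped FourierTransform ENNReal
noncomputable section

abbrev E3 := EuclideanSpace ℝ (Fin 3)

/-- anisotropic Sobolev norm `H^{σ₁,σ₂}(ℝ³)`, defined through the Fourier transform. -/
def anisoNorm (σ₁ σ₂ : ℝ) (f : E3 → ℂ) : ℝ :=
  (∫ ξ : E3, (1 + ((ξ 0)^2 + (ξ 1)^2)) ^ σ₁ * (1 + (ξ 2)^2) ^ σ₂ * ‖𝓕 f ξ‖^2) ^ (1/2 : ℝ)

/-- The `L²` size of a nonnegative function. -/
def lnorm2 {X : Type*} [MeasureSpace X] (f : X → ℝ≥0∞) : ℝ≥0∞ :=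
  (∫⁻ x, f x ^ (2 : ℝ)) ^ (1 / 2 : ℝ)

/-- `C` bounds the trilinear form on `L² × L² × L²` whose kernel is the square root of `k`. -/
def TrilinearBound {X : Type*} [MeasureSpace X] [Sub X] (k : X → X → ℝ≥0∞) (C : ℝ≥0∞) : Prop :=
  ∀ f g h : X → ℝ≥0∞, Measurable f → Measurable g → Measurable h →
    ∫⁻ x, ∫⁻ y, k x y ^ (1 / 2 : ℝ) * (f (x - y) * g y * h x) ≤
      C * (lnorm2 f * lnorm2 g * lnorm2 h)

section Abstract

variable {X : Type*} [MeasureSpace X]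

lemma rpow_half_rpow_two (a : ℝ≥0∞) : (a ^ (1 / 2 : ℝ)) ^ (2 : ℝ) = a := by
  rw [← ENNReal.rpow_mul]; norm_num

lemma lnorm2_rpow_two (f : X → ℝ≥0∞) : lnorm2 f ^ (2 : ℝ) = ∫⁻ x, f x ^ (2 : ℝ) :=
  rpow_half_rpow_two _

lemma measurable_lnorm2_slice {Y : Type*} [MeasureSpace Y] [SFinite (volume : Measure Y)]
    {f : X × Y → ℝ≥0∞} (hf : Measurable f) : Measurable fun x => lnorm2 fun y => f (x, y) :=
  ((hf.pow_const _).lintegral_prod_right').pow_const _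

lemma lnorm2_lnorm2_slice {Y : Type*} [MeasureSpace Y] [SFinite (volume : Measure Y)]
    {f : X × Y → ℝ≥0∞} (hf : Measurable f) :
    lnorm2 (fun x => lnorm2 fun y => f (x, y)) = lnorm2 f := by
  rw [lnorm2]
  simp_rw [lnorm2_rpow_two]
  rw [lnorm2, Measure.volume_eq_prod, lintegral_prod _ (hf.pow_const _).aemeasurable]

lemma lintegral_mul_le_lnorm2 {f g : X → ℝ≥0∞} (hf : Measurable f) (hg : Measurable g) :
    ∫⁻ x, f x * g x ≤ lnorm2 f * lnorm2 g :=
  ENNReal.lintegral_mul_le_Lp_mul_Lq volume Real.HolderConjugate.two_two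
    hf.aemeasurable hg.aemeasurable

lemma TrilinearBound.mono [Sub X] {k l : X → X → ℝ≥0∞} {C : ℝ≥0∞}
    (hl : TrilinearBound l C) (hkl : ∀ x y, k x y ≤ l x y) : TrilinearBound k C := by
  intro f g h hf hg hh
  refine le_trans ?_ (hl f g h hf hg hh)
  gcongr with x y
  exact hkl x y

variable [SFinite (volume : Measure X)] [AddGroup X] [MeasurableAdd₂ X] [MeasurableNeg X]

lemma TrilinearBound.prod {Y : Type*} [MeasureSpace Y] [SFinite (volume : Measure Y)] [AddGroup Y]
    [MeasurableAdd₂ Y] [MeasurableNeg Y]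
    {k : X → X → ℝ≥0∞} {l : Y → Y → ℝ≥0∞} {C D : ℝ≥0∞}
    (hk : Measurable (Function.uncurry k)) (hl : Measurable (Function.uncurry l))
    (hC : TrilinearBound k C) (hD : TrilinearBound l D) :
    TrilinearBound (fun p q : X × Y => k p.1 q.1 * l p.2 q.2) (D * C) := by
  intro f g h hf hg hh
  have hk' : Measurable fun p : X × X => k p.1 p.2 := hk
  have hl' : Measurable fun p : Y × Y => l p.1 p.2 := hl
  have hm : Measurable fun z : (X × Y) × (X × Y) => (k z.1.1 z.2.1 * l z.1.2 z.2.2) ^ (1 / 2 : ℝ) *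
      (f (z.1 - z.2) * g z.2 * h z.1) := by
    have h1 : Measurable fun z : (X × Y) × (X × Y) => k z.1.1 z.2.1 :=
      hk'.comp (f := fun z : (X × Y) × (X × Y) => (z.1.1, z.2.1)) (by fun_prop)
    have h2 : Measurable fun z : (X × Y) × (X × Y) => l z.1.2 z.2.2 :=
      hl'.comp (f := fun z : (X × Y) × (X × Y) => (z.1.2, z.2.2)) (by fun_prop)
    have h3 : Measurable fun z : (X × Y) × (X × Y) => f (z.1 - z.2) :=
      hf.comp (f := fun z : (X × Y) × (X × Y) => (z.1.1 - z.2.1, z.1.2 - z.2.2)) (by fun_prop)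
    exact ((h1.mul h2).pow_const _).mul ((h3.mul (hg.comp measurable_snd)).mul (hh.comp measurable_fst))
  have key : ∀ x x' : X,
      ∫⁻ y, ∫⁻ y', (k x x' * l y y') ^ (1 / 2 : ℝ) *
        (f ((x, y) - (x', y')) * g (x', y') * h (x, y)) ≤
      D * (k x x' ^ (1 / 2 : ℝ) * ((fun a => lnorm2 fun y => f (a, y)) (x - x') *
        (lnorm2 fun y => g (x', y)) * (lnorm2 fun y => h (x, y)))) := by
    intro x x'
    have := hD (fun y => f (x - x', y)) (fun y => g (x', y)) (fun y => h (x, y))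
      (by fun_prop) (by fun_prop) (by fun_prop)
    calc _ = k x x' ^ (1 / 2 : ℝ) * ∫⁻ y, ∫⁻ y', l y y' ^ (1 / 2 : ℝ) *
          (f (x - x', y - y') * g (x', y') * h (x, y)) := by
          have hlm : Measurable fun z : Y × Y => l z.1 z.2 ^ (1 / 2 : ℝ) *
              (f (x - x', z.1 - z.2) * g (x', z.2) * h (x, z.1)) := by fun_prop
          rw [← lintegral_const_mul _ hlm.lintegral_prod_right']
          refine lintegral_congr fun y => ?_
          rw [← lintegral_const_mul _ (by fun_prop)]
          refine lintegral_congr fun y' => ?_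
          rw [ENNReal.mul_rpow_of_nonneg _ _ (by norm_num), mul_assoc]
          rfl
      _ ≤ k x x' ^ (1 / 2 : ℝ) * (D * _) := by gcongr
      _ = _ := by ring
  have hF := measurable_lnorm2_slice hf
  have hG := measurable_lnorm2_slice hg
  have hH := measurable_lnorm2_slice hh
  have := hC _ _ _ hF hG hH
  rw [lnorm2_lnorm2_slice hf, lnorm2_lnorm2_slice hg, lnorm2_lnorm2_slice hh] at this
  calc _ = ∫⁻ x, ∫⁻ x', ∫⁻ y, ∫⁻ y', (k x x' * l y y') ^ (1 / 2 : ℝ) *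
        (f ((x, y) - (x', y')) * g (x', y') * h (x, y)) := by
        rw [Measure.volume_eq_prod, lintegral_prod _ hm.lintegral_prod_right'.aemeasurable]
        refine lintegral_congr fun x => ?_
        have : ∀ y : Y, ∫⁻ q : X × Y, (k x q.1 * l y q.2) ^ (1 / 2 : ℝ) *
            (f ((x, y) - q) * g q * h (x, y)) ∂(volume.prod volume) =
            ∫⁻ x', ∫⁻ y', (k x x' * l y y') ^ (1 / 2 : ℝ) *
              (f ((x, y) - (x', y')) * g (x', y') * h (x, y)) := fun y =>
          lintegral_prod _ (hm.comp (measurable_prodMk_left (x := (x, y)))).aemeasurable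
        simp only [this]
        refine lintegral_lintegral_swap ?_
        refine Measurable.aemeasurable ?_
        refine Measurable.lintegral_prod_right' (f := fun z : (Y × X) × Y =>
          (k x z.1.2 * l z.1.1 z.2) ^ (1 / 2 : ℝ) *
              (f ((x, z.1.1) - (z.1.2, z.2)) * g (z.1.2, z.2) * h (x, z.1.1))) ?_
        exact hm.comp (f := fun z : (Y × X) × Y => ((x, z.1.1), (z.1.2, z.2))) (by fun_prop)
    _ ≤ ∫⁻ x, ∫⁻ x', D * (k x x' ^ (1 / 2 : ℝ) * ((fun a => lnorm2 fun y => f (a, y)) (x - x') *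
        (lnorm2 fun y => g (x', y)) * (lnorm2 fun y => h (x, y)))) :=
        lintegral_mono fun x => lintegral_mono fun x' => key x x'
    _ = D * ∫⁻ x, ∫⁻ x', (k x x' ^ (1 / 2 : ℝ) * ((fun a => lnorm2 fun y => f (a, y)) (x - x') *
        (lnorm2 fun y => g (x', y)) * (lnorm2 fun y => h (x, y)))) := by
        have hm2 : Measurable fun z : X × X => k z.1 z.2 ^ (1 / 2 : ℝ) *
          ((fun a => lnorm2 fun y => f (a, y)) (z.1 - z.2) *
            (lnorm2 fun y => g (z.2, y)) * (lnorm2 fun y => h (z.1, y))) := by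
          have h3 := hF.comp (f := fun z : X × X => z.1 - z.2) (by fun_prop)
          have h4 := hG.comp (f := fun z : X × X => z.2) (by fun_prop)
          have h5 := hH.comp (f := fun z : X × X => z.1) (by fun_prop)
          exact (hk'.pow_const _).mul ((h3.mul h4).mul h5)
        rw [← lintegral_const_mul _ hm2.lintegral_prod_right']
        refine lintegral_congr fun y => ?_
        exact lintegral_const_mul _ (hm2.comp (measurable_prodMk_left (x := y)))
    _ ≤ _ := by
        rw [mul_assoc]
        gcongr

lemma TrilinearBound.add {k l : X → X → ℝ≥0∞} {C D : ℝ≥0∞}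
    (hk : Measurable (Function.uncurry k))
    (hC : TrilinearBound k C) (hD : TrilinearBound l D) :
    TrilinearBound (fun x y => k x y + l x y) (C + D) := by
  intro f g h hf hg hh
  have hk' : Measurable fun p : X × X => k p.1 p.2 := hk
  have hm : Measurable fun z : X × X => k z.1 z.2 ^ (1 / 2 : ℝ) *
      (f (z.1 - z.2) * g z.2 * h z.1) := by fun_prop
  calc _ ≤ ∫⁻ x, ∫⁻ y, (k x y ^ (1 / 2 : ℝ) * (f (x - y) * g y * h x) +
          l x y ^ (1 / 2 : ℝ) * (f (x - y) * g y * h x)) := by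
        gcongr with x y
        rw [← add_mul]
        gcongr
        exact ENNReal.rpow_add_le_add_rpow _ _ (by norm_num) (by norm_num)
    _ = (∫⁻ x, ∫⁻ y, k x y ^ (1 / 2 : ℝ) * (f (x - y) * g y * h x)) +
          ∫⁻ x, ∫⁻ y, l x y ^ (1 / 2 : ℝ) * (f (x - y) * g y * h x) := by
        rw [← lintegral_add_left hm.lintegral_prod_right']
        refine lintegral_congr fun x => ?_
        exact lintegral_add_left (hm.comp (measurable_prodMk_left (x := x))) _
    _ ≤ _ := by
        rw [add_mul]
        exact add_le_add (hC f g h hf hg hh) (hD f g h hf hg hh)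

/-- Schur-type test: the kernel is square integrable in `x`, uniformly in `y`. -/
lemma trilinearBound_of_lintegral_left [(volume : Measure X).IsAddLeftInvariant]
    [(volume : Measure X).IsNegInvariant] {k : X → X → ℝ≥0∞} {C : ℝ≥0∞}
    (hk : Measurable (Function.uncurry k)) (hC : ∀ y, ∫⁻ x, k x y ≤ C) :
    TrilinearBound k (C ^ (1 / 2 : ℝ)) := by
  intro f g h hf hg hh
  have hk' : Measurable fun p : X × X => k p.1 p.2 := hk
  have h1 : lnorm2 (fun z : X × X => k z.1 z.2 ^ (1 / 2 : ℝ) * g z.2) ≤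
      C ^ (1 / 2 : ℝ) * lnorm2 g := by
    rw [lnorm2, lnorm2, ← ENNReal.mul_rpow_of_nonneg _ _ (by norm_num),
      Measure.volume_eq_prod, lintegral_prod_symm' _ (by fun_prop)]
    gcongr
    rw [← lintegral_const_mul _ (by fun_prop)]
    gcongr with y
    simp_rw [ENNReal.mul_rpow_of_nonneg _ _ zero_le_two, rpow_half_rpow_two]
    rw [lintegral_mul_const _ (by fun_prop)]
    gcongr
    exact hC y
  have h2 : lnorm2 (fun z : X × X => f (z.1 - z.2) * h z.1) = lnorm2 f * lnorm2 h := by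
    rw [lnorm2, lnorm2, lnorm2, ← ENNReal.mul_rpow_of_nonneg _ _ (by norm_num),
      Measure.volume_eq_prod, lintegral_prod _ (by fun_prop)]
    congr 1
    rw [← lintegral_const_mul _ (by fun_prop)]
    refine lintegral_congr fun x => ?_
    simp_rw [ENNReal.mul_rpow_of_nonneg _ _ zero_le_two]
    rw [lintegral_mul_const _ (by fun_prop), lintegral_sub_left_eq_self (fun x => f x ^ (2 : ℝ))]
  calc _ = ∫⁻ z : X × X, (k z.1 z.2 ^ (1 / 2 : ℝ) * g z.2) * (f (z.1 - z.2) * h z.1) := by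
        rw [Measure.volume_eq_prod, lintegral_prod _ (by fun_prop)]
        refine lintegral_congr fun x => lintegral_congr fun y => ?_
        ring
    _ ≤ _ := lintegral_mul_le_lnorm2 (by fun_prop) (by fun_prop)
    _ ≤ (C ^ (1 / 2 : ℝ) * lnorm2 g) * (lnorm2 f * lnorm2 h) := by
        rw [h2]; gcongr
    _ = _ := by ring

/-- Schur-type test: the kernel is square integrable in `y`, uniformly in `x`. -/
lemma trilinearBound_of_lintegral_right [(volume : Measure X).IsAddRightInvariant]
    {k : X → X → ℝ≥0∞} {C : ℝ≥0∞}
    (hk : Measurable (Function.uncurry k)) (hC : ∀ x, ∫⁻ y, k x y ≤ C) :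
    TrilinearBound k (C ^ (1 / 2 : ℝ)) := by
  intro f g h hf hg hh
  have hk' : Measurable fun p : X × X => k p.1 p.2 := hk
  have h1 : lnorm2 (fun z : X × X => k z.1 z.2 ^ (1 / 2 : ℝ) * h z.1) ≤
      C ^ (1 / 2 : ℝ) * lnorm2 h := by
    rw [lnorm2, lnorm2, ← ENNReal.mul_rpow_of_nonneg _ _ (by norm_num),
      Measure.volume_eq_prod, lintegral_prod _ (by fun_prop)]
    gcongr
    rw [← lintegral_const_mul _ (by fun_prop)]
    gcongr with y
    simp_rw [ENNReal.mul_rpow_of_nonneg _ _ zero_le_two, rpow_half_rpow_two]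
    rw [lintegral_mul_const _ (by fun_prop)]
    gcongr
    exact hC y
  have h2 : lnorm2 (fun z : X × X => f (z.1 - z.2) * g z.2) = lnorm2 f * lnorm2 g := by
    rw [lnorm2, lnorm2, lnorm2, ← ENNReal.mul_rpow_of_nonneg _ _ (by norm_num),
      Measure.volume_eq_prod, lintegral_prod_symm' _ (by fun_prop)]
    congr 1
    rw [← lintegral_const_mul _ (by fun_prop)]
    refine lintegral_congr fun y => ?_
    simp_rw [ENNReal.mul_rpow_of_nonneg _ _ zero_le_two]
    rw [lintegral_mul_const _ (by fun_prop), lintegral_sub_right_eq_self (fun x => f x ^ (2 : ℝ))]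
  calc _ = ∫⁻ z : X × X, (k z.1 z.2 ^ (1 / 2 : ℝ) * h z.1) * (f (z.1 - z.2) * g z.2) := by
        rw [Measure.volume_eq_prod, lintegral_prod _ (by fun_prop)]
        refine lintegral_congr fun x => lintegral_congr fun y => ?_
        ring
    _ ≤ _ := lintegral_mul_le_lnorm2 (by fun_prop) (by fun_prop)
    _ ≤ (C ^ (1 / 2 : ℝ) * lnorm2 h) * (lnorm2 f * lnorm2 g) := by
        rw [h2]; gcongr
    _ = _ := by ring

end Abstract

section Weights

lemma rpow_le_four_rpow_abs_mul_rpow {x y : ℝ} (hx : 0 < x) (hy : 0 < y) (hxy : x ≤ 4 * y)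
    (hyx : y ≤ 4 * x) (r : ℝ) : x ^ r ≤ 4 ^ |r| * y ^ r := by
  rcases le_total 0 r with hr | hr
  · rw [abs_of_nonneg hr, ← mul_rpow (by norm_num) hy.le]
    exact rpow_le_rpow hx.le hxy hr
  · rw [abs_of_nonpos hr, rpow_neg (by norm_num), ← inv_rpow (by norm_num),
      ← mul_rpow (by norm_num) hy.le]
    exact rpow_le_rpow_of_nonpos (by positivity) (by linarith) hr

lemma vertical_weight_le_of_nonneg {A B D s t : ℝ} (hA : 0 < A) (hB : 0 < B) (hD : 0 < D)
    (hABD : A ≤ 2 * (B + D)) (ht : 0 ≤ t) (hts : t ≤ s) :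
    A ^ t * B ^ (-s) * D ^ (-t) ≤ 4 ^ |t| * (A ^ (-s) + B ^ (-s) + D ^ (-s)) := by
  rw [abs_of_nonneg ht]
  rcases le_total B D with h | h
  · calc A ^ t * B ^ (-s) * D ^ (-t) ≤ (4 * D) ^ t * B ^ (-s) * D ^ (-t) := by
          gcongr; linarith
      _ = 4 ^ t * B ^ (-s) := by
          rw [mul_rpow (by norm_num) hD.le, rpow_neg hD.le]
          field_simp
      _ ≤ _ := by
          gcongr
          linarith [rpow_nonneg hA.le (-s), rpow_nonneg hD.le (-s)]
  · calc A ^ t * B ^ (-s) * D ^ (-t) ≤ (4 * B) ^ t * B ^ (-s) * D ^ (-t) := by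
          gcongr; linarith
      _ = 4 ^ t * (B ^ (t - s) * D ^ (-t)) := by
          rw [mul_rpow (by norm_num) hB.le, sub_eq_add_neg t s, rpow_add hB]
          ring
      _ ≤ 4 ^ t * (D ^ (t - s) * D ^ (-t)) := by
          gcongr 4 ^ t * (?_ * _)
          exact rpow_le_rpow_of_nonpos hD h (by linarith)
      _ = 4 ^ t * D ^ (-s) := by
          rw [← rpow_add hD]; ring_nf
      _ ≤ _ := by
          gcongr
          linarith [rpow_nonneg hA.le (-s), rpow_nonneg hB.le (-s)]

lemma vertical_weight_le {A B D s t : ℝ} (hA : 0 < A) (hB : 0 < B) (hD : 0 < D)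
    (hA' : A ≤ 2 * (B + D)) (hD' : D ≤ 2 * (A + B)) (hts : t ≤ s) (hst : 0 < s + t) :
    A ^ t * B ^ (-s) * D ^ (-t) ≤ 4 ^ |t| * (A ^ (-s) + B ^ (-s) + D ^ (-s)) := by
  rcases le_total 0 t with ht | ht
  · exact vertical_weight_le_of_nonneg hA hB hD hA' ht hts
  · have := vertical_weight_le_of_nonneg (s := s) (t := -t) hD hB hA (by linarith)
      (by linarith) (by linarith)
    rw [abs_neg, neg_neg] at this
    linarith

/-- The scale-invariant weight `x ^ (-a) * y ^ (a - 1)` localized to `x ≤ y`. -/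
def lowWeight (a x y : ℝ) : ℝ := if x ≤ y then x ^ (-a) * y ^ (a - 1) else 0

lemma lowWeight_nonneg {a x y : ℝ} (hx : 0 ≤ x) (hy : 0 ≤ y) : 0 ≤ lowWeight a x y := by
  unfold lowWeight; split_ifs <;> positivity

lemma horizontal_weight_le {A B D a b c : ℝ} (hA : 0 < A) (hB : 0 < B) (hD : 0 < D)
    (hA' : A ≤ 2 * (B + D)) (hB' : B ≤ 2 * (A + D)) (hD' : D ≤ 2 * (A + B)) (habc : a + b + c = 1) :
    A ^ (-a) * B ^ (-b) * D ^ (-c) ≤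
      4 ^ (|a| + |b|) * (lowWeight a A D + lowWeight b B D + lowWeight c D A) := by
  have h4a : (4 : ℝ) ^ |a| ≤ 4 ^ (|a| + |b|) := by gcongr <;> simp
  have h4b : (4 : ℝ) ^ |b| ≤ 4 ^ (|a| + |b|) := by gcongr <;> simp
  have n1 := lowWeight_nonneg (a := a) hA.le hD.le
  have n2 := lowWeight_nonneg (a := b) hB.le hD.le
  have n3 := lowWeight_nonneg (a := c) hD.le hA.le
  rcases le_total A D with h1 | h1
  · rcases le_total A B with h2 | h2
    · calc A ^ (-a) * B ^ (-b) * D ^ (-c)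
          ≤ A ^ (-a) * (4 ^ |-b| * D ^ (-b)) * D ^ (-c) := by
            gcongr
            exact rpow_le_four_rpow_abs_mul_rpow hB hD (by linarith) (by linarith) _
        _ = 4 ^ |b| * lowWeight a A D := by
            rw [lowWeight, if_pos h1, abs_neg, show a - 1 = -b + -c by linarith, rpow_add hD]
            ring
        _ ≤ _ := by gcongr; linarith
    · calc A ^ (-a) * B ^ (-b) * D ^ (-c)
          ≤ (4 ^ |-a| * D ^ (-a)) * B ^ (-b) * D ^ (-c) := by
            gcongr
            exact rpow_le_four_rpow_abs_mul_rpow hA hD (by linarith) (by linarith) _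
        _ = 4 ^ |a| * lowWeight b B D := by
            rw [lowWeight, if_pos (h2.trans h1), abs_neg, show b - 1 = -a + -c by linarith,
              rpow_add hD]
            ring
        _ ≤ _ := by gcongr; linarith
  · rcases le_total B D with h2 | h2
    · calc A ^ (-a) * B ^ (-b) * D ^ (-c)
          ≤ (4 ^ |-a| * D ^ (-a)) * B ^ (-b) * D ^ (-c) := by
            gcongr
            exact rpow_le_four_rpow_abs_mul_rpow hA hD (by linarith) (by linarith) _
        _ = 4 ^ |a| * lowWeight b B D := by
            rw [lowWeight, if_pos h2, abs_neg, show b - 1 = -a + -c by linarith,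
              rpow_add hD]
            ring
        _ ≤ _ := by gcongr; linarith
    · calc A ^ (-a) * B ^ (-b) * D ^ (-c)
          ≤ A ^ (-a) * (4 ^ |-b| * A ^ (-b)) * D ^ (-c) := by
            gcongr
            exact rpow_le_four_rpow_abs_mul_rpow hB hA (by linarith) (by linarith) _
        _ = 4 ^ |b| * lowWeight c D A := by
            rw [lowWeight, if_pos h1, abs_neg, show c - 1 = -a + -b by linarith, rpow_add hA]
            ring
        _ ≤ _ := by gcongr; linarith

/-- The squared Japanese bracket on `ℝ × ℝ` with its Euclidean structure. -/
def planeBracket (p : ℝ × ℝ) : ℝ := 1 + (p.1 ^ 2 + p.2 ^ 2)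

/-- The squared Japanese bracket on `ℝ`. -/
def lineBracket (t : ℝ) : ℝ := 1 + t ^ 2

lemma planeBracket_pos (p : ℝ × ℝ) : 0 < planeBracket p := by unfold planeBracket; positivity

lemma lineBracket_pos (t : ℝ) : 0 < lineBracket t := by unfold lineBracket; positivity

@[fun_prop]
lemma measurable_planeBracket : Measurable planeBracket := by unfold planeBracket; fun_prop

@[fun_prop]
lemma measurable_lineBracket : Measurable lineBracket := by unfold lineBracket; fun_prop

lemma lintegral_lineBracket_rpow_lt_top {s : ℝ} (hs : 1 / 2 < s) :
    ∫⁻ t, ENNReal.ofReal (lineBracket t ^ (-s)) < ∞ := by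
  have h := integrable_rpow_neg_one_add_norm_sq (E := ℝ) (μ := volume) (r := 2 * s)
    (by simp; linarith)
  refine (h.congr (ae_of_all _ fun t => ?_)).lintegral_lt_top
  simp [lineBracket, neg_div]

lemma lintegral_radial_le {a D : ℝ} (ha : a < 1) (hD : 1 ≤ D) :
    ∫⁻ r in Set.Ioi (0 : ℝ), ENNReal.ofReal r * ENNReal.ofReal (lowWeight a (1 + r ^ 2) D) ≤
      ENNReal.ofReal (1 / (2 * (1 - a))) := by
  set R := √(D - 1) with hR
  have hR2 : R ^ 2 = D - 1 := sq_sqrt (by linarith)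
  have hderiv : ∀ r ∈ Set.uIcc 0 R, HasDerivAt
      (fun r : ℝ => (1 + r ^ 2) ^ (1 - a) / (2 * (1 - a)) * D ^ (a - 1))
      (r * ((1 + r ^ 2) ^ (-a) * D ^ (a - 1))) r := by
    intro r _
    have h1 : HasDerivAt (fun r : ℝ => 1 + r ^ 2) (2 * r) r := by
      simpa using (hasDerivAt_pow 2 r).const_add 1
    have h2 := ((h1.rpow_const (p := 1 - a) (Or.inl (by positivity))).div_const
      (2 * (1 - a))).mul_const (D ^ (a - 1))
    refine h2.congr_deriv ?_
    rw [show 1 - a - 1 = -a by ring]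
    have : 1 - a ≠ 0 := by linarith
    field_simp
  have hcont : Continuous fun r : ℝ => r * ((1 + r ^ 2) ^ (-a) * D ^ (a - 1)) := by
    have : Continuous fun r : ℝ => (1 + r ^ 2) ^ (-a) :=
      (by fun_prop : Continuous fun r : ℝ => 1 + r ^ 2).rpow_const fun r => Or.inl (by positivity)
    fun_prop
  have hint := intervalIntegral.integral_eq_sub_of_hasDerivAt hderiv
    (hcont.intervalIntegrable 0 R)
  rw [intervalIntegral.integral_of_le (sqrt_nonneg _)] at hint
  calc _ ≤ ∫⁻ r in Set.Ioi (0 : ℝ), (Set.Ioc 0 R).indicator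
        (fun r => ENNReal.ofReal (r * ((1 + r ^ 2) ^ (-a) * D ^ (a - 1)))) r := by
        refine setLIntegral_mono' measurableSet_Ioi fun r hr => ?_
        have hr : 0 < r := hr
        rw [← ENNReal.ofReal_mul hr.le, lowWeight]
        split_ifs with h
        · have : r ≤ R := by
            rw [hR]; exact le_sqrt_of_sq_le (by linarith)
          rw [Set.indicator_of_mem (by exact ⟨hr, this⟩)]
        · simp
    _ ≤ ∫⁻ r, (Set.Ioc 0 R).indicator
        (fun r => ENNReal.ofReal (r * ((1 + r ^ 2) ^ (-a) * D ^ (a - 1)))) r :=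
        setLIntegral_le_lintegral _ _
    _ = ENNReal.ofReal (∫ r in Set.Ioc 0 R, r * ((1 + r ^ 2) ^ (-a) * D ^ (a - 1))) := by
        rw [lintegral_indicator measurableSet_Ioc, ofReal_integral_eq_lintegral_ofReal]
        · exact (hcont.integrableOn_Icc (a := 0) (b := R)).mono_set Set.Ioc_subset_Icc_self
        · filter_upwards [ae_restrict_mem measurableSet_Ioc] with r hr
          have := hr.1
          positivity
    _ ≤ _ := by
        rw [hint]
        apply ENNReal.ofReal_le_ofReal
        have h1 : 0 < 1 - a := by linarith
        have h2 : (1 + R ^ 2) ^ (1 - a) / (2 * (1 - a)) * D ^ (a - 1) = 1 / (2 * (1 - a)) := by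
          rw [hR2, add_sub_cancel, div_mul_eq_mul_div, ← rpow_add (by linarith)]
          simp
        rw [h2]
        simp
        positivity

lemma lintegral_lowWeight_planeBracket_le {a D : ℝ} (ha : a < 1) (hD : 1 ≤ D) :
    ∫⁻ p, ENNReal.ofReal (lowWeight a (planeBracket p) D) ≤
      ENNReal.ofReal (1 / (2 * (1 - a))) * ENNReal.ofReal (2 * π) := by
  rw [← lintegral_comp_polarCoord_symm]
  have h : ∀ p : ℝ × ℝ, planeBracket (polarCoord.symm p) = 1 + p.1 ^ 2 := by
    intro p
    simp only [planeBracket, polarCoord_symm_apply]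
    linear_combination p.1 ^ 2 * sin_sq_add_cos_sq p.2
  simp only [h, polarCoord_target, Measure.volume_eq_prod, smul_eq_mul]
  rw [← Measure.prod_restrict, lintegral_prod]
  · simp only [lintegral_const, Measure.restrict_apply_univ, volume_Ioo]
    rw [lintegral_mul_const]
    · rw [show π - -π = 2 * π by ring]
      gcongr
      exact lintegral_radial_le ha hD
    · unfold lowWeight
      refine Measurable.mul (by fun_prop) (ENNReal.measurable_ofReal.comp ?_)
      exact Measurable.ite (measurableSet_le (by fun_prop) (by fun_prop)) (by fun_prop) (by fun_prop)
  · unfold lowWeight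
    refine (Measurable.mul (by fun_prop) (ENNReal.measurable_ofReal.comp ?_)).aemeasurable
    exact Measurable.ite (measurableSet_le (by fun_prop) (by fun_prop)) (by fun_prop) (by fun_prop)

end Weights

section Kernels

lemma trilinearBound_vertical {s t : ℝ} (hs : 1 / 2 < s) (hts : t ≤ s) (hst : 0 < s + t) :
    ∃ C < ∞, TrilinearBound (fun x y : ℝ => ENNReal.ofReal
      (lineBracket x ^ t * lineBracket (x - y) ^ (-s) * lineBracket y ^ (-t))) C := by
  set I := ∫⁻ x, ENNReal.ofReal (lineBracket x ^ (-s)) with hI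
  have hI_top : I < ∞ := lintegral_lineBracket_rpow_lt_top hs
  set M := ENNReal.ofReal (4 ^ |t|) with hM
  have hl : TrilinearBound (fun x y : ℝ => M * (ENNReal.ofReal (lineBracket x ^ (-s)) +
      ENNReal.ofReal (lineBracket (x - y) ^ (-s)))) ((M * (I + I)) ^ (1 / 2 : ℝ)) := by
    refine trilinearBound_of_lintegral_left ?_ fun y => ?_
    · unfold Function.uncurry; fun_prop
    · rw [lintegral_const_mul _ (by fun_prop), lintegral_add_left (by fun_prop),
        lintegral_sub_right_eq_self (fun x => ENNReal.ofReal (lineBracket x ^ (-s)))]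
  have hr : TrilinearBound (fun _ y : ℝ => M * ENNReal.ofReal (lineBracket y ^ (-s)))
      ((M * I) ^ (1 / 2 : ℝ)) := by
    refine trilinearBound_of_lintegral_right ?_ fun x => ?_
    · unfold Function.uncurry; fun_prop
    · rw [lintegral_const_mul _ (by fun_prop)]
  refine ⟨_, ?_, (hl.add (by unfold Function.uncurry; fun_prop) hr).mono fun x y => ?_⟩
  · have hM_top : M < ∞ := ENNReal.ofReal_lt_top
    refine ENNReal.add_lt_top.2 ⟨ENNReal.rpow_lt_top_of_nonneg (by norm_num) ?_,
      ENNReal.rpow_lt_top_of_nonneg (by norm_num) ?_⟩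
    · exact (ENNReal.mul_lt_top hM_top (ENNReal.add_lt_top.2 ⟨hI_top, hI_top⟩)).ne
    · exact (ENNReal.mul_lt_top hM_top hI_top).ne
  · have hx := lineBracket_pos x
    have hy := lineBracket_pos y
    have hxy := lineBracket_pos (x - y)
    rw [← mul_add, ← ENNReal.ofReal_add (by positivity) (by positivity),
      ← ENNReal.ofReal_add (by positivity) (by positivity), ← ENNReal.ofReal_mul (by positivity)]
    refine ENNReal.ofReal_le_ofReal (vertical_weight_le hx hxy hy ?_ ?_ hts hst)
    · unfold lineBracket; nlinarith [sq_nonneg (x - 2 * y)]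
    · unfold lineBracket; nlinarith [sq_nonneg (2 * x - y)]

@[fun_prop]
lemma Measurable.lowWeight {X : Type*} [MeasurableSpace X] {f g : X → ℝ} (a : ℝ)
    (hf : Measurable f) (hg : Measurable g) : Measurable fun x => lowWeight a (f x) (g x) := by
  unfold _root_.lowWeight
  exact Measurable.ite (measurableSet_le hf hg) (by fun_prop) (by fun_prop)

lemma one_le_planeBracket (p : ℝ × ℝ) : 1 ≤ planeBracket p := by
  unfold planeBracket; nlinarith [sq_nonneg p.1, sq_nonneg p.2]

lemma trilinearBound_horizontal {a b c : ℝ} (ha : a < 1) (hb : b < 1) (hc : c < 1)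
    (habc : a + b + c = 1) :
    ∃ C < ∞, TrilinearBound (fun x y : ℝ × ℝ => ENNReal.ofReal
      (planeBracket x ^ (-a) * planeBracket (x - y) ^ (-b) * planeBracket y ^ (-c))) C := by
  set M := ENNReal.ofReal (4 ^ (|a| + |b|)) with hM
  let I : ℝ → ℝ≥0∞ := fun a => ENNReal.ofReal (1 / (2 * (1 - a))) * ENNReal.ofReal (2 * π)
  have hI_top : ∀ a, I a < ∞ := fun a => ENNReal.mul_lt_top ENNReal.ofReal_lt_top ENNReal.ofReal_lt_top
  have hl : TrilinearBound (fun x y : ℝ × ℝ => M *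
      (ENNReal.ofReal (lowWeight a (planeBracket x) (planeBracket y)) +
        ENNReal.ofReal (lowWeight b (planeBracket (x - y)) (planeBracket y))))
      ((M * (I a + I b)) ^ (1 / 2 : ℝ)) := by
    refine trilinearBound_of_lintegral_left ?_ fun y => ?_
    · unfold Function.uncurry; fun_prop
    · rw [lintegral_const_mul _ (by fun_prop), lintegral_add_left (by fun_prop),
        lintegral_sub_right_eq_self
          (fun x => ENNReal.ofReal (lowWeight b (planeBracket x) (planeBracket y)))]
      gcongr
      · exact lintegral_lowWeight_planeBracket_le ha (one_le_planeBracket y)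
      · exact lintegral_lowWeight_planeBracket_le hb (one_le_planeBracket y)
  have hr : TrilinearBound (fun x y : ℝ × ℝ => M *
      ENNReal.ofReal (lowWeight c (planeBracket y) (planeBracket x)))
      ((M * I c) ^ (1 / 2 : ℝ)) := by
    refine trilinearBound_of_lintegral_right ?_ fun x => ?_
    · unfold Function.uncurry; fun_prop
    · rw [lintegral_const_mul _ (by fun_prop)]
      gcongr
      exact lintegral_lowWeight_planeBracket_le hc (one_le_planeBracket x)
  refine ⟨_, ?_, (hl.add (by unfold Function.uncurry; fun_prop) hr).mono fun x y => ?_⟩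
  · have hM_top : M < ∞ := ENNReal.ofReal_lt_top
    refine ENNReal.add_lt_top.2 ⟨ENNReal.rpow_lt_top_of_nonneg (by norm_num) ?_,
      ENNReal.rpow_lt_top_of_nonneg (by norm_num) ?_⟩
    · exact (ENNReal.mul_lt_top hM_top (ENNReal.add_lt_top.2 ⟨hI_top a, hI_top b⟩)).ne
    · exact (ENNReal.mul_lt_top hM_top (hI_top c)).ne
  · have hx := planeBracket_pos x
    have hy := planeBracket_pos y
    have hxy := planeBracket_pos (x - y)
    have n1 := lowWeight_nonneg (a := a) hx.le hy.le
    have n2 := lowWeight_nonneg (a := b) hxy.le hy.le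
    have n3 := lowWeight_nonneg (a := c) hy.le hx.le
    rw [← mul_add, ← ENNReal.ofReal_add n1 n2,
      ← ENNReal.ofReal_add (by positivity) n3, ← ENNReal.ofReal_mul (by positivity)]
    refine ENNReal.ofReal_le_ofReal (horizontal_weight_le hx hxy hy ?_ ?_ ?_ habc)
    all_goals simp only [planeBracket, Prod.fst_sub, Prod.snd_sub]
    · nlinarith [sq_nonneg (x.1 - 2 * y.1), sq_nonneg (x.2 - 2 * y.2)]
    · nlinarith [sq_nonneg (x.1 + y.1), sq_nonneg (x.2 + y.2)]
    · nlinarith [sq_nonneg (2 * x.1 - y.1), sq_nonneg (2 * x.2 - y.2)]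

/-- The squared anisotropic weight; the vertical frequency is the first coordinate. -/
def anisoWeight (a b : ℝ) (p : ℝ × ℝ × ℝ) : ℝ := planeBracket p.2 ^ a * lineBracket p.1 ^ b

lemma anisoWeight_nonneg (a b : ℝ) (p : ℝ × ℝ × ℝ) : 0 ≤ anisoWeight a b p :=
  mul_nonneg (rpow_nonneg (planeBracket_pos _).le _) (rpow_nonneg (lineBracket_pos _).le _)

@[fun_prop]
lemma measurable_anisoWeight (a b : ℝ) : Measurable (anisoWeight a b) := by
  unfold anisoWeight; fun_prop

/-- The weighted `L²` norm on the frequency side. -/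
def weightedNorm (a b : ℝ) (f : ℝ × ℝ × ℝ → ℝ≥0∞) : ℝ≥0∞ :=
  lnorm2 fun p => ENNReal.ofReal (anisoWeight a b p) ^ (1 / 2 : ℝ) * f p

lemma weightedNorm_le_of_le_convolution {σ σ' s₀ s₁ : ℝ}
    (hσ : σ < 1) (hσ' : σ' < 1) (hσσ' : 0 < σ + σ')
    (hs₀ : 1 / 2 < s₀) (hs₁ : s₁ ≤ s₀) (hsum : 0 < s₀ + s₁) :
    ∃ C < ∞, ∀ f g h : ℝ × ℝ × ℝ → ℝ≥0∞, Measurable f → Measurable g → Measurable h →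
      (∀ x, h x ≤ ∫⁻ y, f (x - y) * g y) → weightedNorm (σ + σ' - 1) s₁ h < ∞ →
      weightedNorm (σ + σ' - 1) s₁ h ≤ C * weightedNorm σ s₀ f * weightedNorm σ' s₁ g := by
  obtain ⟨C, hC, hCk⟩ := trilinearBound_vertical hs₀ hs₁ hsum
  obtain ⟨D, hD, hDk⟩ := trilinearBound_horizontal (a := 1 - σ - σ') (b := σ) (c := σ')
    (by linarith) hσ hσ' (by ring)
  have key := hCk.prod (by unfold Function.uncurry; fun_prop)
    (by unfold Function.uncurry; fun_prop) hDk
  refine ⟨D * C, ENNReal.mul_lt_top hD hC, fun f g h hf hg hh hconv hfin => ?_⟩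
  set N := weightedNorm (σ + σ' - 1) s₁ h with hN
  have hbound := key (fun p => ENNReal.ofReal (anisoWeight σ s₀ p) ^ (1 / 2 : ℝ) * f p)
    (fun p => ENNReal.ofReal (anisoWeight σ' s₁ p) ^ (1 / 2 : ℝ) * g p)
    (fun p => ENNReal.ofReal (anisoWeight (σ + σ' - 1) s₁ p) ^ (1 / 2 : ℝ) * h p)
    (by fun_prop) (by fun_prop) (by fun_prop)
  have hsq : N * N ≤ (D * C * weightedNorm σ s₀ f * weightedNorm σ' s₁ g) * N := by
    calc N * N = ∫⁻ x, (ENNReal.ofReal (anisoWeight (σ + σ' - 1) s₁ x) ^ (1 / 2 : ℝ) * h x) ^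
          (2 : ℝ) := by
          rw [← lnorm2_rpow_two, ENNReal.rpow_two, sq]; rfl
      _ ≤ ∫⁻ x, ∫⁻ y, (ENNReal.ofReal (anisoWeight (σ + σ' - 1) s₁ x) ^ (1 / 2 : ℝ) *
          (ENNReal.ofReal (anisoWeight (σ + σ' - 1) s₁ x) ^ (1 / 2 : ℝ) * h x)) *
          (f (x - y) * g y) := by
          refine lintegral_mono fun x => ?_
          have hm : Measurable fun y => f (x - y) * g y :=
            (hf.comp (f := fun y : ℝ × ℝ × ℝ => x - y) (by fun_prop)).mul hg
          rw [lintegral_const_mul _ hm]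
          calc _ = (ENNReal.ofReal (anisoWeight (σ + σ' - 1) s₁ x) ^ (1 / 2 : ℝ) *
              (ENNReal.ofReal (anisoWeight (σ + σ' - 1) s₁ x) ^ (1 / 2 : ℝ) * h x)) * h x := by
                rw [ENNReal.rpow_two]; ring
            _ ≤ _ := by gcongr; exact hconv x
      _ = _ := ?_
      _ ≤ _ := hbound
      _ = _ := by simp only [hN, weightedNorm]; ring
    refine lintegral_congr fun x => lintegral_congr fun y => ?_
    have hw : ENNReal.ofReal (anisoWeight (σ + σ' - 1) s₁ x) ^ (1 / 2 : ℝ) =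
        (ENNReal.ofReal (lineBracket x.1 ^ s₁ * lineBracket (x.1 - y.1) ^ (-s₀) *
            lineBracket y.1 ^ (-s₁)) *
          ENNReal.ofReal (planeBracket x.2 ^ (-(1 - σ - σ')) * planeBracket (x.2 - y.2) ^ (-σ) *
            planeBracket y.2 ^ (-σ'))) ^ (1 / 2 : ℝ) *
        ENNReal.ofReal (anisoWeight σ s₀ (x - y)) ^ (1 / 2 : ℝ) *
        ENNReal.ofReal (anisoWeight σ' s₁ y) ^ (1 / 2 : ℝ) := by
      have h1 := lineBracket_pos x.1
      have h2 := lineBracket_pos y.1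
      have h3 := lineBracket_pos (x.1 - y.1)
      have h4 := planeBracket_pos x.2
      have h5 := planeBracket_pos y.2
      have h6 := planeBracket_pos (x.2 - y.2)
      rw [← ENNReal.mul_rpow_of_nonneg _ _ (by norm_num),
        ← ENNReal.mul_rpow_of_nonneg _ _ (by norm_num), ← ENNReal.ofReal_mul (by positivity),
        ← ENNReal.ofReal_mul (by positivity),
        ← ENNReal.ofReal_mul (mul_nonneg (by positivity) (anisoWeight_nonneg _ _ _))]
      congr 2
      simp only [anisoWeight, Prod.fst_sub, Prod.snd_sub]
      rw [rpow_neg h3.le, rpow_neg h2.le, rpow_neg h6.le, rpow_neg h5.le,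
        show -(1 - σ - σ') = σ + σ' - 1 by ring]
      field_simp
    rw [mul_assoc]
    conv_lhs => arg 1; rw [hw]
    ring
  rcases eq_or_ne N 0 with h0 | h0
  · rw [h0]; exact zero_le
  · exact (ENNReal.mul_le_mul_iff_left h0 hfin.ne).1 hsq

end Kernels

section Frequency

/-- Reordering of coordinates, with the vertical one first. -/
def ofVerticalHorizontal (p : ℝ × ℝ × ℝ) : E3 := !₂[p.2.1, p.2.2, p.1]

lemma ofVerticalHorizontal_sub (p q : ℝ × ℝ × ℝ) :
    ofVerticalHorizontal (p - q) = ofVerticalHorizontal p - ofVerticalHorizontal q := by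
  ext i; fin_cases i <;> simp [ofVerticalHorizontal]

lemma measurePreserving_ofVerticalHorizontal : MeasurePreserving ofVerticalHorizontal := by
  have h1 := (volume_preserving_piFinSuccAbove (fun _ : Fin 3 => ℝ) 2).symm
  have h2 : MeasurePreserving
      (Prod.map id (MeasurableEquiv.finTwoArrow (α := ℝ)).symm : ℝ × ℝ × ℝ → ℝ × (Fin 2 → ℝ)) :=
    (MeasurePreserving.id (volume : Measure ℝ)).prod (volume_preserving_finTwoArrow ℝ).symm
  have h3 := (PiLp.volume_preserving_toLp (Fin 3)).comp (h1.comp h2)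
  convert h3 using 1
  ext p i
  fin_cases i <;>
    simp [ofVerticalHorizontal, MeasurableEquiv.piFinSuccAbove, MeasurableEquiv.finTwoArrow,
      Fin.insertNthEquiv, Fin.insertNth, Fin.succAboveCases]

lemma anisoNorm_eq_toReal (a b : ℝ) (f : SchwartzMap E3 ℂ) :
    anisoNorm a b f =
      (weightedNorm a b fun p => ‖𝓕 f (ofVerticalHorizontal p)‖ₑ).toReal := by
  have hmeas : Measurable fun ξ : E3 =>
      (1 + ((ξ 0) ^ 2 + (ξ 1) ^ 2)) ^ a * (1 + (ξ 2) ^ 2) ^ b * ‖𝓕 f ξ‖ ^ 2 := by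
    have := (𝓕 f).continuous.measurable
    fun_prop
  rw [anisoNorm, ← SchwartzMap.fourier_coe, integral_eq_lintegral_of_nonneg_ae
    (ae_of_all _ fun ξ => by positivity) hmeas.aestronglyMeasurable,
    ← measurePreserving_ofVerticalHorizontal.lintegral_comp hmeas.ennreal_ofReal,
    ENNReal.toReal_rpow, weightedNorm, lnorm2]
  congr 3 with p
  rw [ENNReal.mul_rpow_of_nonneg _ _ zero_le_two, rpow_half_rpow_two, ENNReal.rpow_two,
    ← ofReal_norm, ← ENNReal.ofReal_pow (norm_nonneg _),
    ← ENNReal.ofReal_mul (anisoWeight_nonneg _ _ _)]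
  simp [anisoWeight, planeBracket, lineBracket, ofVerticalHorizontal]

lemma weightedNorm_fourier_lt_top (a b : ℝ) (f : SchwartzMap E3 ℂ) :
    weightedNorm a b (fun p => ‖𝓕 f (ofVerticalHorizontal p)‖ₑ) < ∞ := by
  set F := 𝓕 f with hF
  have hg := Function.hasTemperateGrowth_one_add_norm_sq_rpow E3 (|a| + |b|)
  set G := SchwartzMap.smulLeftCLM ℂ (fun x : E3 => (1 + ‖x‖ ^ 2) ^ (|a| + |b|)) F with hG
  have hint : Integrable fun ξ => ‖G ξ‖ * ‖F ξ‖ := by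
    have := (G.memLp 2 volume).norm.integrable_mul (F.memLp 2 volume).norm
    exact this
  refine ENNReal.rpow_lt_top_of_nonneg (by norm_num) (ne_of_lt ?_)
  refine lt_of_le_of_lt ?_ hint.lintegral_lt_top
  rw [← measurePreserving_ofVerticalHorizontal.lintegral_comp (by
    have := G.continuous.measurable
    have := F.continuous.measurable
    fun_prop)]
  refine lintegral_mono fun p => ?_
  beta_reduce
  rw [ENNReal.mul_rpow_of_nonneg _ _ zero_le_two, rpow_half_rpow_two, ENNReal.rpow_two,
    ← ofReal_norm, ← ENNReal.ofReal_pow (norm_nonneg _),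
    ← ENNReal.ofReal_mul (anisoWeight_nonneg _ _ _)]
  refine ENNReal.ofReal_le_ofReal ?_
  rw [hG, SchwartzMap.smulLeftCLM_apply_apply hg, norm_smul, sq, ← mul_assoc]
  gcongr
  have hnorm : 1 + ‖ofVerticalHorizontal p‖ ^ 2 = 1 + (p.2.1 ^ 2 + p.2.2 ^ 2 + p.1 ^ 2) := by
    simp [EuclideanSpace.norm_sq_eq, Fin.sum_univ_three, ofVerticalHorizontal]
  rw [Real.norm_of_nonneg (by positivity), rpow_add (by positivity), hnorm]
  have hrpow : ∀ {x y r : ℝ}, 1 ≤ x → x ≤ y → x ^ r ≤ y ^ |r| := fun hx hxy =>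
    (rpow_le_rpow_of_exponent_le hx (le_abs_self _)).trans
      (rpow_le_rpow (by linarith) hxy (abs_nonneg _))
  refine mul_le_mul (hrpow (one_le_planeBracket _) ?_) (hrpow ?_ ?_)
    (rpow_nonneg (lineBracket_pos _).le _) (by positivity)
  · simp only [planeBracket]; nlinarith [sq_nonneg p.1]
  · simp only [lineBracket]; nlinarith [sq_nonneg p.1]
  · simp only [lineBracket]; nlinarith [sq_nonneg p.2.1, sq_nonneg p.2.2]

lemma fourier_mul_eq_integral {E : Type*} [NormedAddCommGroup E] [InnerProductSpace ℝ E]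
    [FiniteDimensional ℝ E] [MeasurableSpace E] [BorelSpace E] (u v : SchwartzMap E ℂ) (ξ : E) :
    𝓕 (fun x => u x * v x) ξ = ∫ η, 𝓕 u (ξ - η) * 𝓕 v η := by
  set w := SchwartzMap.convolution (ContinuousLinearMap.mul ℂ ℂ) (𝓕⁻ u) (𝓕⁻ v) with hw
  have h1 : ∀ x, 𝓕 w x = u x * v x := fun x => by
    rw [hw, SchwartzMap.fourier_convolution]
    simp
  have h2 : 𝓕 (fun x => u x * v x) ξ = w (-ξ) := by
    have : (fun x => u x * v x) = (𝓕 w : SchwartzMap E ℂ) := funext fun x => (h1 x).symm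
    rw [this, ← neg_neg ξ, ← Real.fourierInv_eq_fourier_neg, ← SchwartzMap.fourierInv_coe]
    simp
  have hinv : ∀ (f : SchwartzMap E ℂ) (x : E), 𝓕⁻ f x = 𝓕 f (-x) := fun f x => by
    rw [SchwartzMap.fourierInv_coe, SchwartzMap.fourier_coe, Real.fourierInv_eq_fourier_neg]
  rw [h2, hw, SchwartzMap.convolution_apply, convolution_eq_swap, ← integral_neg_eq_self]
  refine integral_congr_ae (ae_of_all _ fun η => ?_)
  simp only [hinv, ContinuousLinearMap.mul_apply']
  congr 2
  · abel
  · simp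

lemma enorm_fourier_mul_le (u v : SchwartzMap E3 ℂ) (p : ℝ × ℝ × ℝ) :
    ‖𝓕 (fun x => u x * v x) (ofVerticalHorizontal p)‖ₑ ≤
      ∫⁻ q, ‖𝓕 u (ofVerticalHorizontal (p - q))‖ₑ * ‖𝓕 v (ofVerticalHorizontal q)‖ₑ := by
  have hm : Measurable fun η => ‖𝓕 u (ofVerticalHorizontal p - η)‖ₑ * ‖𝓕 v η‖ₑ := by
    have := (𝓕 u).continuous.measurable
    have := (𝓕 v).continuous.measurable
    fun_prop
  simp_rw [ofVerticalHorizontal_sub]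
  rw [fourier_mul_eq_integral, measurePreserving_ofVerticalHorizontal.lintegral_comp hm]
  refine (enorm_integral_le_lintegral_enorm _).trans_eq (lintegral_congr fun η => ?_)
  rw [enorm_mul]

end Frequency

theorem anisotropic_product_law_high_vertical_regularity (σ σ' s₀ s₁ : ℝ)
    (hσ : σ < 1) (hσ' : σ' < 1) (hσσ' : 0 < σ + σ')
    (hs₀ : 1/2 < s₀) (hs₁ : s₁ ≤ s₀) (hsum : 0 < s₀ + s₁) :
    ∃ C > (0:ℝ), ∀ u v : SchwartzMap E3 ℂ,
      anisoNorm (σ + σ' - 1) s₁ (fun x => u x * v x) ≤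
        C * anisoNorm σ s₀ (u : E3 → ℂ) * anisoNorm σ' s₁ (v : E3 → ℂ) := by
  obtain ⟨C, hC, hbound⟩ := weightedNorm_le_of_le_convolution hσ hσ' hσσ' hs₀ hs₁ hsum
  refine ⟨C.toReal + 1, by positivity, fun u v => ?_⟩
  have hmeas : ∀ f : SchwartzMap E3 ℂ,
      Measurable fun p => ‖𝓕 f (ofVerticalHorizontal p)‖ₑ := fun f =>
    ((𝓕 f).continuous.measurable.comp measurePreserving_ofVerticalHorizontal.measurable).enorm
  let w : SchwartzMap E3 ℂ := SchwartzMap.pairing (ContinuousLinearMap.mul ℂ ℂ) u v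
  have hw : (fun x => u x * v x) = w := by ext x; simp [w]
  have hu := weightedNorm_fourier_lt_top σ s₀ u
  have hv := weightedNorm_fourier_lt_top σ' s₁ v
  have key := hbound _ _ _ (hmeas u) (hmeas v) (hmeas w)
    (fun p => by simpa only [hw, SchwartzMap.fourier_coe] using enorm_fourier_mul_le u v p)
    (weightedNorm_fourier_lt_top _ _ w)
  rw [hw, anisoNorm_eq_toReal, anisoNorm_eq_toReal, anisoNorm_eq_toReal]
  calc _ ≤ _ := ENNReal.toReal_mono
        (ENNReal.mul_lt_top (ENNReal.mul_lt_top hC hu) hv).ne key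
    _ ≤ _ := by
        rw [ENNReal.toReal_mul, ENNReal.toReal_mul]
        gcongr
        linarith
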